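/- Consider equation (**) with p := ∑_{j=1}^m p_j > δ and hypotheses (H0), (H1), (H2). Then every positive solution x of (**) satisfies K e^{−(2δ+p)C} ≤ liminf_{t→∞} x(t) ≤ limsup_{t→∞} x(t) ≤ K e^{2(δ+p)C}, where K > 0 is the unique positive equilibrium defined by ∑_{j=1}^m p_j e^{−a_j K} = δ and C = limsup_{t→∞} ∫_{t−τ}^t β(s) ds. -/

import Mathlib

open Real Filter MeasureTheory Set

noncomputable section

/-- A positive (admissible) solution of the Nicholson equation (**)
`x'(t) = β(t) (-δ x(t) + ∑ j, p j * x (t - τd j t) * exp (-(a j * x (t - σd j t))))`,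
considered for `t ≥ 0`, with nonnegative continuous initial data on `[-τ, 0)` and `x 0 > 0`. -/
def IsPosSolB (m : ℕ) (β : ℝ → ℝ) (δ : ℝ) (p a : Fin m → ℝ)
    (τd σd : Fin m → ℝ → ℝ) (τ : ℝ) (x : ℝ → ℝ) : Prop :=
  ContinuousOn x (Ici (-τ)) ∧
  (∀ θ ∈ Ico (-τ) (0:ℝ), 0 ≤ x θ) ∧ 0 < x 0 ∧
  ∀ t ≥ (0:ℝ), HasDerivWithinAt x
      (β t * (-(δ * x t) +
        ∑ j, p j * x (t - τd j t) * Real.exp (-(a j * x (t - σd j t)))))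
      (Ici 0) t

/-- Hypothesis (H0): `δ, p j, a j` are positive constants, `β` is continuous and positive
on `[0,∞)`, and the delays are continuous, nonnegative and bounded. -/
def HypH0 (m : ℕ) (β : ℝ → ℝ) (δ : ℝ) (p a : Fin m → ℝ)
    (τd σd : Fin m → ℝ → ℝ) : Prop :=
  0 < δ ∧ (∀ j, 0 < p j) ∧ (∀ j, 0 < a j) ∧
  (ContinuousOn β (Ici 0) ∧ ∀ t ≥ (0:ℝ), 0 < β t) ∧
  (∀ j, ContinuousOn (τd j) (Ici 0) ∧ ContinuousOn (σd j) (Ici 0) ∧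
      (∀ t ≥ (0:ℝ), 0 ≤ τd j t ∧ 0 ≤ σd j t) ∧
      ∃ B : ℝ, ∀ t ≥ (0:ℝ), τd j t ≤ B ∧ σd j t ≤ B)

/-- `τ = max_j max (sup_t τd j t, sup_t σd j t)`: the supremum of all the delays. -/
def IsMaxDelayB (m : ℕ) (τd σd : Fin m → ℝ → ℝ) (τ : ℝ) : Prop :=
  IsLUB {r : ℝ | ∃ j : Fin m, ∃ t : ℝ, 0 ≤ t ∧ (r = τd j t ∨ r = σd j t)} τ

/-- Hypothesis (H1): `∫_0^∞ β(s) ds = ∞`. -/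
def HypH1 (β : ℝ → ℝ) : Prop :=
  Filter.Tendsto (fun t => ∫ s in (0:ℝ)..t, β s) Filter.atTop Filter.atTop

/-- Barrier lemma: a function with positive derivative on each touching of level `c` stays above. -/
lemma aux_crossing (y y' : ℝ → ℝ) (t₁ c : ℝ) (hd : ∀ t ≥ t₁, HasDerivAt y (y' t) t)
    (h0 : c ≤ y t₁)
    (h : ∀ t ≥ t₁, (∀ u ∈ Icc t₁ t, c ≤ y u) → y t = c → 0 < y' t) :
    ∀ t ≥ t₁, c ≤ y t := by
  by_contra! hcon
  obtain ⟨t, ht, hyt⟩ := hcon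
  set S : Set ℝ := {t | t₁ ≤ t ∧ y t < c} with hS
  have hne : S.Nonempty := ⟨t, ht, hyt⟩
  have hbd : BddBelow S := ⟨t₁, fun s hs => hs.1⟩
  set t₀ := sInf S with ht0
  have h10 : t₁ ≤ t₀ := le_csInf hne fun s hs => hs.1
  have hbelow : ∀ u, t₁ ≤ u → u < t₀ → c ≤ y u := by
    intro u hu hut
    by_contra hh
    exact absurd (csInf_le hbd (show u ∈ S from ⟨hu, not_le.1 hh⟩)) (not_le.2 hut)
  have hcont := (hd t₀ h10).continuousAt
  have hge : c ≤ y t₀ := by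
    rcases h10.eq_or_lt with he | hlt
    · rw [← he]; exact h0
    · have htend : Tendsto y (nhdsWithin t₀ (Iio t₀)) (nhds (y t₀)) :=
        hcont.tendsto.mono_left nhdsWithin_le_nhds
      refine ge_of_tendsto htend ?_
      filter_upwards [Ioo_mem_nhdsLT hlt] with u hu
      exact hbelow u hu.1.le hu.2
  have hev : ∀ᶠ u in nhdsWithin t₀ (Ioi t₀), c ≤ y u := by
    rcases hge.eq_or_lt with he | hlt
    · have hpos := h t₀ h10 (fun u hu => by
        rcases hu.2.eq_or_lt with h1 | h1
        · rw [h1]; exact hge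
        · exact hbelow u hu.1 h1) he.symm
      have hs := (hasDerivAt_iff_tendsto_slope.1 (hd t₀ h10))
      have hs' : Tendsto (slope y t₀) (nhdsWithin t₀ (Ioi t₀)) (nhds (y' t₀)) :=
        hs.mono_left (nhdsWithin_mono _ fun u hu => ne_of_gt hu)
      filter_upwards [hs'.eventually (lt_mem_nhds hpos), self_mem_nhdsWithin] with u hu1 hu2
      rw [slope_def_field] at hu1
      have h2 : 0 < u - t₀ := sub_pos.2 hu2
      have := (div_pos_iff_of_pos_right h2).1 hu1
      linarith
    · exact (hcont.tendsto.mono_left nhdsWithin_le_nhds).eventually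
        ((lt_mem_nhds hlt).mono fun _ h => h.le)
  obtain ⟨w, hw, hw2⟩ := (mem_nhdsGT_iff_exists_Ioo_subset).1 hev
  obtain ⟨s, hs, hsw⟩ := exists_lt_of_csInf_lt hne (show sInf S < w from hw)
  have hs0 : t₀ ≤ s := csInf_le hbd hs
  rcases hs0.eq_or_lt with he | hlt
  · rw [he] at hge; exact absurd hs.2 (not_lt.2 hge)
  · exact absurd hs.2 (not_lt.2 (hw2 ⟨hlt, hsw⟩))

/-- Abstract asymptotic lower bound. -/
lemma aux_abstract (y y' β I : ℝ → ℝ) (τ T₀ κ δ b n₀ : ℝ) (hτ : 0 ≤ τ) (hκ : 0 < κ) (hδ : 0 < δ)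
    (hd : ∀ t ≥ T₀, HasDerivAt y (y' t) t) (hβ : ∀ t ≥ T₀, 0 < β t)
    (hI : ∀ t ≥ T₀, HasDerivAt I (β t) t) (hIT : Tendsto I atTop atTop)
    (h : ∀ t ≥ T₀, ∀ n, 0 < (κ - δ) * n → (∀ u ∈ Icc (t - τ) t, n ≤ y u) → y t < b →
      β t * (κ * n - δ * y t) ≤ y' t)
    (hb : 0 < (κ - δ) * b) (hn₀ : 0 < (κ - δ) * n₀) (hnb : n₀ < b)
    (hw : ∀ u ∈ Icc (T₀ - τ) T₀, n₀ ≤ y u) :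
    ∀ b' < b, ∀ᶠ t in atTop, b' ≤ y t := by
  -- convexity
  have hconv : ∀ n, n₀ ≤ n → n ≤ b → 0 < (κ - δ) * n := by
    intro n h1 h2
    rcases le_total 0 (κ - δ) with h3 | h3
    · nlinarith
    · nlinarith
  -- step 1
  have h1 : ∀ t ≥ T₀, n₀ ≤ y t := by
    refine aux_crossing y y' T₀ n₀ hd (hw T₀ ⟨by linarith, le_rfl⟩) ?_
    intro t ht hu hyt
    have := h t ht n₀ hn₀ (fun u hu' => by
      rcases le_total T₀ u with h2 | h2
      · exact hu u ⟨h2, hu'.2⟩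
      · exact hw u ⟨by linarith [hu'.1], h2⟩) (by rw [hyt]; exact hnb)
    rw [hyt] at this
    have h3 : 0 < β t * (κ * n₀ - δ * n₀) := mul_pos (hβ t ht) (by linarith)
    linarith
  -- step 2
  have h2 : ∀ n, n₀ ≤ n → n ≤ b → (∀ᶠ t in atTop, n ≤ y t) → ∀ c < b, δ * c < κ * n →
      ∀ᶠ t in atTop, c ≤ y t := by
    intro n hn1 hn2 hev c hc hcn
    obtain ⟨T1, hT1⟩ := eventually_atTop.1 hev
    set T := max T₀ (T1 + τ) with hT
    have hTT : T₀ ≤ T := le_max_left _ _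
    have hTT1 : T1 + τ ≤ T := le_max_right _ _
    have hyp : ∀ t ≥ T, y t < b → β t * (κ * n - δ * y t) ≤ y' t := by
      intro t ht hyb
      exact h t (hTT.trans ht) n (hconv n hn1 hn2) (fun u hu => hT1 u (by linarith [hu.1])) hyb
    have hex : ∃ t₁ ≥ T, c ≤ y t₁ := by
      by_contra! hcon
      set η := κ * n - δ * c with hη
      have hηp : 0 < η := by simp only [hη]; linarith
      have hmono : MonotoneOn (fun t => y t - η * I t) (Ici T) := by
        refine monotoneOn_of_deriv_nonneg (convex_Ici T) ?_ ?_ ?_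
        · intro t ht
          exact (((hd t (hTT.trans ht)).sub ((hI t (hTT.trans ht)).const_mul η)).continuousAt).continuousWithinAt
        · intro t ht
          rw [interior_Ici] at ht
          exact ((hd t (hTT.trans (le_of_lt ht))).sub ((hI t (hTT.trans (le_of_lt ht))).const_mul η)).differentiableAt.differentiableWithinAt
        · intro t ht
          rw [interior_Ici] at ht
          have ht' : T ≤ t := le_of_lt ht
          have hD := ((hd t (hTT.trans ht')).sub ((hI t (hTT.trans ht')).const_mul η)).deriv
          have : deriv (fun t => y t - η * I t) t = y' t - η * β t := hD
          rw [this]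
          have h3 := hyp t ht' ((hcon t ht').trans hc)
          have h4 : β t * η ≤ β t * (κ * n - δ * y t) := by
            refine mul_le_mul_of_nonneg_left ?_ (hβ t (hTT.trans ht')).le
            have := hcon t ht'
            simp only [hη]
            nlinarith
          linarith
      obtain ⟨t, ht1, ht2⟩ := ((hIT.eventually_ge_atTop ((c - y T) / η + I T + 1)).and
        (eventually_ge_atTop T)).exists
      have h5 := hmono (mem_Ici.2 le_rfl) (mem_Ici.2 ht2) ht2
      have h6 := hcon t ht2
      simp only at h5
      have h7 : (c - y T) / η * η = c - y T := div_mul_cancel₀ _ hηp.ne'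
      nlinarith
    obtain ⟨t₁, ht₁, hct⟩ := hex
    filter_upwards [eventually_ge_atTop t₁] with t ht
    refine aux_crossing y y' t₁ c (fun s hs => hd s (hTT.trans (ht₁.trans hs))) hct ?_ t ht
    intro s hs _ hys
    have h3 := hyp s (ht₁.trans hs) (by rw [hys]; exact hc)
    rw [hys] at h3
    exact lt_of_lt_of_le (mul_pos (hβ s (hTT.trans (ht₁.trans hs))) (by linarith)) h3
  -- step 3
  set S : Set ℝ := {n | n₀ ≤ n ∧ n ≤ b ∧ ∀ᶠ t in atTop, n ≤ y t} with hS
  have hn0S : n₀ ∈ S := ⟨le_rfl, hnb.le, (eventually_ge_atTop T₀).mono h1⟩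
  have hbd : BddAbove S := ⟨b, fun n hn => hn.2.1⟩
  set s := sSup S with hs
  have hs1 : n₀ ≤ s := le_csSup hbd hn0S
  have hs2 : s ≤ b := csSup_le ⟨n₀, hn0S⟩ fun n hn => hn.2.1
  have hsb : s = b := by
    by_contra hne
    have hlt : s < b := lt_of_le_of_ne hs2 hne
    have hPs := hconv s hs1 hs2
    set ε := min ((b - s) / 2) ((κ - δ) * s / (2 * (κ + δ))) with hε
    have hε0 : 0 < ε := lt_min (by linarith) (by positivity)
    have hε1 : ε ≤ (b - s) / 2 := min_le_left _ _
    have hε2 : ε * (2 * (κ + δ)) ≤ (κ - δ) * s :=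
      (le_div_iff₀ (by positivity)).1 (min_le_right _ _)
    obtain ⟨n, hn, hns⟩ := exists_lt_of_lt_csSup ⟨n₀, hn0S⟩ (show s - ε < sSup S by linarith)
    have hc := h2 n hn.1 hn.2.1 hn.2.2 (s + ε) (by linarith) (by nlinarith)
    have : s + ε ≤ s := le_csSup hbd ⟨by linarith, by linarith, hc⟩
    linarith
  intro b' hb'
  obtain ⟨n, hn, hns⟩ := exists_lt_of_lt_csSup ⟨n₀, hn0S⟩ (show b' < sSup S by rw [← hs, hsb]; exact hb')
  exact hn.2.2.mono fun t ht => hns.le.trans ht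

/-- A primitive of `β`. -/
lemma aux_prim (β : ℝ → ℝ) (hc : ContinuousOn β (Ici 0)) :
    ∃ I : ℝ → ℝ, (∀ t, HasDerivAt I (β (max t 0)) t) ∧
      ∀ s t, 0 ≤ s → 0 ≤ t → ∫ u in s..t, β u = I t - I s := by
  have hcont : Continuous fun t => β (max t 0) :=
    hc.comp_continuous (by fun_prop) fun t => mem_Ici.2 (le_max_right _ _)
  refine ⟨fun t => ∫ u in (0:ℝ)..t, β (max u 0), fun t => ?_, fun s t hs ht => ?_⟩
  · exact intervalIntegral.integral_hasDerivAt_right (hcont.intervalIntegrable _ _)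
      (hcont.stronglyMeasurableAtFilter _ _) hcont.continuousAt
  · simp only
    rw [intervalIntegral.integral_interval_sub_left (hcont.intervalIntegrable _ _)
      (hcont.intervalIntegrable _ _)]
    refine intervalIntegral.integral_congr fun u hu => ?_
    have : 0 ≤ u := (le_min hs ht).trans hu.1
    simp only [max_eq_left this]

lemma aux_mono (x F β I : ℝ → ℝ) (δ t₀ : ℝ) (hxc : ContinuousOn x (Ici 0))
    (hd : ∀ t > 0, HasDerivAt x (β t * (-(δ * x t) + F t)) t)
    (hI : ∀ t > 0, HasDerivAt I (β t) t) (hIc : Continuous I)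
    (hβ : ∀ t ≥ 0, 0 < β t) (hF : ∀ t, 0 < t → t < t₀ → 0 ≤ F t) :
    MonotoneOn (fun t => x t * Real.exp (δ * I t)) (Icc 0 t₀) := by
  have hD : ∀ t > 0, HasDerivAt (fun t => x t * Real.exp (δ * I t))
      (β t * F t * Real.exp (δ * I t)) t := by
    intro t ht
    have := (hd t ht).mul (((hI t ht).const_mul δ).exp)
    refine this.congr_deriv ?_
    ring
  refine monotoneOn_of_deriv_nonneg (convex_Icc 0 t₀) ?_ ?_ ?_
  · refine (hxc.mono fun t ht => ht.1).mul ?_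
    fun_prop
  · intro t ht
    rw [interior_Icc] at ht
    exact (hD t ht.1).differentiableAt.differentiableWithinAt
  · intro t ht
    rw [interior_Icc] at ht
    rw [(hD t ht.1).deriv]
    exact mul_nonneg (mul_nonneg (hβ t ht.1.le).le (hF t ht.1 ht.2)) (Real.exp_pos _).le

lemma aux_pos (x F β I : ℝ → ℝ) (δ τ : ℝ) (hτ : 0 ≤ τ) (hxc : ContinuousOn x (Ici (-τ)))
    (hx0 : 0 < x 0) (hneg : ∀ θ ∈ Ico (-τ) (0:ℝ), 0 ≤ x θ)
    (hd : ∀ t > 0, HasDerivAt x (β t * (-(δ * x t) + F t)) t)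
    (hI : ∀ t > 0, HasDerivAt I (β t) t) (hIc : Continuous I)
    (hβ : ∀ t ≥ 0, 0 < β t)
    (hF : ∀ t ≥ 0, (∀ u, -τ ≤ u → u ≤ t → 0 ≤ x u) → 0 ≤ F t) :
    ∀ t ≥ 0, 0 < x t := by
  have hxc0 : ContinuousOn x (Ici 0) := hxc.mono (Ici_subset_Ici.2 (by linarith))
  by_contra! hcon
  obtain ⟨t, ht, hxt⟩ := hcon
  set S : Set ℝ := Ici 0 ∩ x ⁻¹' (Iic 0) with hS
  have hcl : IsClosed S := hxc0.preimage_isClosed_of_isClosed isClosed_Ici isClosed_Iic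
  have hbd : BddBelow S := ⟨0, fun s hs => hs.1⟩
  have hmem := hcl.csInf_mem ⟨t, ht, hxt⟩ hbd
  set t₀ := sInf S with ht0
  have h0 : 0 ≤ t₀ := hmem.1
  have hlt : ∀ u, 0 ≤ u → u < t₀ → 0 ≤ x u := by
    intro u hu hut
    by_contra hh
    exact absurd (csInf_le hbd (show u ∈ S from ⟨hu, (not_le.1 hh).le⟩)) (not_le.2 hut)
  have hm := aux_mono x F β I δ t₀ hxc0 hd hI hIc hβ (fun s hs hst => hF s hs.le fun u hu1 hu2 => by
    rcases lt_or_ge u 0 with h | h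
    · exact hneg u ⟨hu1, h⟩
    · exact hlt u h (by linarith))
  have h1 := hm ⟨le_rfl, h0⟩ ⟨h0, le_rfl⟩ h0
  simp only at h1
  have h2 : x t₀ ≤ 0 := hmem.2
  have h3 : 0 < x 0 * Real.exp (δ * I 0) := by positivity
  have h4 : x t₀ * Real.exp (δ * I t₀) ≤ 0 := mul_nonpos_of_nonpos_of_nonneg h2 (Real.exp_pos _).le
  linarith

/-- Upper growth estimate. -/
lemma aux_grow (x F β I : ℝ → ℝ) (δ τ P A u : ℝ) (hδ : 0 < δ) (hP : 0 < P) (hA : 0 < A) (hu : 0 < u)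
    (hτ : 0 ≤ τ)
    (hd : ∀ t > 0, HasDerivAt x (β t * (-(δ * x t) + F t)) t)
    (hI : ∀ t > 0, HasDerivAt I (β t) t) (hImono : MonotoneOn I (Ici 0))
    (hβ : ∀ t ≥ 0, 0 < β t)
    (hF : ∀ t ≥ u, ∀ M, (∀ w ∈ Icc (t - τ) t, x w ≤ M) → F t ≤ P * M)
    (hw : ∀ w ∈ Icc (u - τ) u, x w ≤ A) :
    ∀ t ≥ u, x t ≤ A * Real.exp (P * (I t - I u)) := by
  have key := aux_crossing (fun t => A * Real.exp (P * (I t - I u)) - x t)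
    (fun t => A * (Real.exp (P * (I t - I u)) * (P * β t)) - β t * (-(δ * x t) + F t)) u 0
    (fun t ht => by
      have ht' : 0 < t := lt_of_lt_of_le hu ht
      exact ((((hI t ht').sub_const (I u)).const_mul P).exp.const_mul A).sub (hd t ht'))
    (by
      have := hw u ⟨by linarith, le_rfl⟩
      simp only [sub_self, mul_zero, Real.exp_zero, mul_one]
      linarith)
    (by
      intro t ht hpast heq
      have ht' : 0 < t := lt_of_lt_of_le hu ht
      set Z := A * Real.exp (P * (I t - I u)) with hZ
      have hZp : 0 < Z := by positivity
      have hxZ : x t = Z := by linarith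
      have hAZ : A ≤ Z := by
        have h1 : I u ≤ I t := hImono hu.le ht'.le ht
        have h2 : 1 ≤ Real.exp (P * (I t - I u)) :=
          Real.one_le_exp (mul_nonneg hP.le (by linarith))
        simp only [hZ]; nlinarith
      have hFt := hF t ht Z (fun w hw' => by
        rcases le_total u w with h | h
        · have h1 := hpast w ⟨h, hw'.2⟩
          have h2 : I w ≤ I t := hImono (mem_Ici.2 (hu.le.trans h)) ht'.le hw'.2
          have h3 : A * Real.exp (P * (I w - I u)) ≤ Z := by
            simp only [hZ]; gcongr
          linarith
        · exact (hw w ⟨by linarith [hw'.1], h⟩).trans hAZ)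
      have e : A * (Real.exp (P * (I t - I u)) * (P * β t)) = β t * (P * Z) := by
        simp only [hZ]; ring
      rw [e, hxZ, ← mul_sub]
      exact mul_pos (hβ t ht'.le) (by nlinarith [mul_pos hδ hZp]))
  intro t ht
  have := key t ht
  linarith

/-- For (**) with `p = ∑ j, p j > δ` and (H0)--(H2), every positive solution
satisfies `K e^{-(2δ+p)C} ≤ liminf x ≤ limsup x ≤ K e^{2(δ+p)C}`, where `K` is the positive
equilibrium (`∑ j, p j e^{-a_j K} = δ`) and `C = limsup_{t→∞} ∫_{t-τ}^t β(s) ds`. -/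
theorem permanence_bounds_for_eq_star_star
    (m : ℕ) (hm : 0 < m) (β : ℝ → ℝ) (δ : ℝ) (p a : Fin m → ℝ)
    (τd σd : Fin m → ℝ → ℝ) (τ : ℝ)
    (hH0 : HypH0 m β δ p a τd σd) (hτ : IsMaxDelayB m τd σd τ)
    (hp : δ < ∑ j, p j)
    (hH1 : HypH1 β)
    (C : ℝ)
    (hC : C = Filter.limsup (fun t => ∫ s in t - τ..t, β s) Filter.atTop)
    (hH2 : Filter.IsBoundedUnder (· ≤ ·) Filter.atTop (fun t => ∫ s in t - τ..t, β s))
    (K : ℝ) (hKpos : 0 < K) (hK : (∑ j, p j * Real.exp (-(a j * K))) = δ)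
    (x : ℝ → ℝ) (hx : IsPosSolB m β δ p a τd σd τ x) :
    K * Real.exp (-((2 * δ + ∑ j, p j) * C)) ≤ Filter.liminf x Filter.atTop ∧
      Filter.liminf x Filter.atTop ≤ Filter.limsup x Filter.atTop ∧
      Filter.limsup x Filter.atTop ≤ K * Real.exp (2 * (δ + ∑ j, p j) * C) := by
  obtain ⟨hδ, hpp, hap, ⟨hβc, hβ⟩, hdel⟩ := hH0
  obtain ⟨hxc, hneg, hx0, hder⟩ := hx
  set P := ∑ j, p j with hP
  have hPpos : 0 < P := hδ.trans hp
  have hτj : ∀ j, ∀ t ≥ (0:ℝ), τd j t ≤ τ := fun j t ht => hτ.1 ⟨j, t, ht, Or.inl rfl⟩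
  have hσj : ∀ j, ∀ t ≥ (0:ℝ), σd j t ≤ τ := fun j t ht => hτ.1 ⟨j, t, ht, Or.inr rfl⟩
  have hτj0 : ∀ j, ∀ t ≥ (0:ℝ), 0 ≤ τd j t := fun j t ht => ((hdel j).2.2.1 t ht).1
  have hσj0 : ∀ j, ∀ t ≥ (0:ℝ), 0 ≤ σd j t := fun j t ht => ((hdel j).2.2.1 t ht).2
  have hτ0 : 0 ≤ τ := (hτj0 ⟨0, hm⟩ 0 le_rfl).trans (hτj ⟨0, hm⟩ 0 le_rfl)
  have hτmem : ∀ j, ∀ t ≥ (0:ℝ), t - τd j t ∈ Icc (t - τ) t := fun j t ht =>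
    ⟨by linarith [hτj j t ht], by linarith [hτj0 j t ht]⟩
  have hσmem : ∀ j, ∀ t ≥ (0:ℝ), t - σd j t ∈ Icc (t - τ) t := fun j t ht =>
    ⟨by linarith [hσj j t ht], by linarith [hσj0 j t ht]⟩
  obtain ⟨I, hI', hIint⟩ := aux_prim β hβc
  have hI : ∀ t > 0, HasDerivAt I (β t) t := fun t ht => by
    have := hI' t
    rwa [max_eq_left ht.le] at this
  have hIc : Continuous I := continuous_iff_continuousAt.2 fun t => (hI' t).continuousAt
  have hIm : Monotone I := by
    refine monotone_of_deriv_nonneg (fun t => (hI' t).differentiableAt) fun t => ?_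
    rw [(hI' t).deriv]
    exact (hβ _ (le_max_right _ _)).le
  have hIT : Tendsto I atTop atTop := by
    have h1 : Tendsto (fun t => (∫ s in (0:ℝ)..t, β s) + I 0) atTop atTop :=
      tendsto_atTop_add_const_right _ _ hH1
    refine h1.congr' ?_
    filter_upwards [eventually_ge_atTop (0:ℝ)] with t ht
    rw [hIint 0 t le_rfl ht]; ring
  set F : ℝ → ℝ := fun t => ∑ j, p j * x (t - τd j t) * Real.exp (-(a j * x (t - σd j t))) with hFdef
  have hd : ∀ t > 0, HasDerivAt x (β t * (-(δ * x t) + F t)) t := fun t ht =>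
    (hder t ht.le).hasDerivAt (Ici_mem_nhds ht)
  have hxpos : ∀ t ≥ 0, 0 < x t := by
    refine aux_pos x F β I δ τ hτ0 hxc hx0 hneg hd hI hIc hβ ?_
    intro t ht hu
    refine Finset.sum_nonneg fun j _ => ?_
    have h1 := hτmem j t ht
    have := hu (t - τd j t) (by linarith [h1.1]) h1.2
    have := (hpp j).le
    positivity
  have hxnn : ∀ t ≥ -τ, 0 ≤ x t := fun t ht => by
    rcases lt_or_ge t 0 with h | h
    · exact hneg t ⟨ht, h⟩
    · exact (hxpos t h).le
  have hFnn : ∀ t ≥ 0, 0 ≤ F t := by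
    intro t ht
    refine Finset.sum_nonneg fun j _ => ?_
    have h1 := hτmem j t ht
    have := hxnn (t - τd j t) (by linarith [h1.1])
    have := (hpp j).le
    positivity
  -- decay estimate
  have hdecay : ∀ s t, 0 ≤ s → s ≤ t → x s ≤ x t * Real.exp (δ * (I t - I s)) := by
    intro s t hs hst
    have hmn := aux_mono x F β I δ t (hxc.mono (Ici_subset_Ici.2 (by linarith))) hd hI hIc hβ
      (fun u hu _ => hFnn u hu.le)
    have h1 := hmn ⟨hs, hst⟩ ⟨hs.trans hst, le_rfl⟩ hst
    simp only at h1
    have h2 : Real.exp (δ * (I t - I s)) = Real.exp (δ * I t) / Real.exp (δ * I s) := by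
      rw [← Real.exp_sub]; ring_nf
    rw [h2, ← mul_div_assoc, le_div_iff₀ (Real.exp_pos _)]
    exact h1
  -- integral bounds
  have hC0 : 0 ≤ C := by
    rw [hC]
    refine le_limsup_of_frequently_le (Eventually.frequently ?_) hH2
    filter_upwards [eventually_ge_atTop τ] with t ht
    rw [hIint (t - τ) t (by linarith) (by linarith)]
    have := hIm (show t - τ ≤ t by linarith)
    linarith
  have hCev : ∀ C' > C, ∃ T, τ < T ∧ ∀ t ≥ T, I t - I (t - τ) ≤ C' := by
    intro C' hC'
    rw [hC] at hC'
    obtain ⟨T, hT⟩ := eventually_atTop.1 (eventually_lt_of_limsup_lt hC' hH2)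
    refine ⟨max T (τ + 1), lt_of_lt_of_le (by linarith) (le_max_right _ _), fun t ht => ?_⟩
    have h1 : τ + 1 ≤ t := (le_max_right _ _).trans ht
    have := hT t ((le_max_left _ _).trans ht)
    rw [hIint (t - τ) t (by linarith) (by linarith)] at this
    exact this.le
  have hβ' : ∀ T, τ < T → ∀ t ≥ T, 0 < t := fun T hT t ht => by
    linarith [show T ≤ t from ht]
  -- lower bound
  have hlow : ∀ K' C', 0 < K' → K' < K → C < C' → ∀ b' < K' * Real.exp (-(δ * C')),
      ∀ᶠ t in atTop, b' ≤ x t := by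
    intro K' C' hK'0 hK'K hCC'
    obtain ⟨T, hTτ, hT⟩ := hCev C' hCC'
    set κ := ∑ j, p j * Real.exp (-(a j * K')) with hκ
    have hκδ : δ < κ := by
      rw [← hK, hκ]
      refine Finset.sum_lt_sum_of_nonempty ⟨⟨0, hm⟩, Finset.mem_univ _⟩ fun j _ => ?_
      have := hap j
      have := hpp j
      gcongr
    set b := K' * Real.exp (-(δ * C')) with hb
    have hb0 : 0 < b := by positivity
    obtain ⟨w, hw, hwmin⟩ := (isCompact_Icc (a := T - τ) (b := T)).exists_isMinOn
      ⟨T, by linarith, le_rfl⟩ (hxc.mono fun u hu => mem_Ici.2 (by linarith [hu.1]))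
    have hxw : 0 < x w := hxpos w (by linarith [hw.1])
    refine aux_abstract x (fun t => β t * (-(δ * x t) + F t)) β I τ T κ δ b (min (x w) (b / 2))
      hτ0 (hδ.trans hκδ) hδ (fun t ht => hd t (hβ' T hTτ t ht)) (fun t ht => hβ t (hβ' T hTτ t ht).le)
      (fun t ht => hI t (hβ' T hTτ t ht)) hIT ?_ (mul_pos (by linarith) hb0)
      (mul_pos (by linarith) (lt_min hxw (by linarith)))
      (lt_of_le_of_lt (min_le_right _ _) (by linarith))
      (fun u hu => (min_le_left _ _).trans (hwmin hu))
    intro t ht n hn hwin hxb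
    have ht0 := hβ' T hTτ t ht
    have hn0 : 0 < n := (pos_iff_pos_of_mul_pos hn).1 (by linarith)
    have hsmall : ∀ u ∈ Icc (t - τ) t, x u ≤ K' := by
      intro u hu
      by_contra hcon
      push Not at hcon
      have hu0 : 0 ≤ u := by linarith [hu.1, show T ≤ t from ht]
      have h1 := hdecay u t hu0 hu.2
      have h2 : I t - I u ≤ C' := by
        have := hT t ht
        have := hIm hu.1
        linarith
      have h3 : x t * Real.exp (δ * (I t - I u)) ≤ x t * Real.exp (δ * C') := by
        have := hxpos t ht0.le
        gcongr
      have h4 : x t * Real.exp (δ * C') < b * Real.exp (δ * C') := by gcongr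
      have h5 : b * Real.exp (δ * C') = K' := by
        rw [hb, mul_assoc, ← Real.exp_add]; simp
      linarith
    refine mul_le_mul_of_nonneg_left ?_ (hβ t ht0.le).le
    have : κ * n ≤ F t := by
      rw [hκ, hFdef, Finset.sum_mul]
      refine Finset.sum_le_sum fun j _ => ?_
      have h1 := hwin _ (hτmem j t ht0.le)
      have h2 := hsmall _ (hσmem j t ht0.le)
      have h3 := hap j
      have h4 := hpp j
      calc p j * Real.exp (-(a j * K')) * n = p j * n * Real.exp (-(a j * K')) := by ring
        _ ≤ _ := by gcongr; exact mul_nonneg h4.le (hn0.le.trans h1)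
    linarith
  -- upper bound
  have hupp : ∀ K' C', K < K' → C < C' → ∀ b' > K' * Real.exp ((δ + P) * C'),
      ∀ᶠ t in atTop, x t ≤ b' := by
    intro K' C' hK'K hCC'
    have hK'0 : 0 < K' := hKpos.trans hK'K
    obtain ⟨T', hTτ', hT'⟩ := hCev C' hCC'
    set T := T' + τ with hTdef
    have hTτ : τ < T := by linarith
    set κ := ∑ j, p j * Real.exp (-(a j * K')) with hκ
    have hκδ : κ < δ := by
      rw [← hK, hκ]
      refine Finset.sum_lt_sum_of_nonempty ⟨⟨0, hm⟩, Finset.mem_univ _⟩ fun j _ => ?_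
      have := hap j
      have := hpp j
      gcongr
    have hκ0 : 0 < κ := Finset.sum_pos (fun j _ => mul_pos (hpp j) (Real.exp_pos _))
      ⟨⟨0, hm⟩, Finset.mem_univ _⟩
    set B := K' * Real.exp ((δ + P) * C') with hB
    have hB0 : 0 < B := by positivity
    obtain ⟨w, hw, hwmax⟩ := (isCompact_Icc (a := T - τ) (b := T)).exists_isMaxOn
      ⟨T, by linarith, le_rfl⟩ (hxc.mono fun u hu => mem_Ici.2 (by linarith [hu.1]))
    have habs := aux_abstract (fun t => - x t) (fun t => -(β t * (-(δ * x t) + F t))) β I τ T κ δ (-B)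
      (-(max (x w) (2 * B)))
      hτ0 hκ0 hδ (fun t ht => (hd t (hβ' T hTτ t ht)).neg)
      (fun t ht => hβ t (hβ' T hTτ t ht).le)
      (fun t ht => hI t (hβ' T hTτ t ht)) hIT ?_ (by nlinarith)
      (by nlinarith [le_max_right (x w) (2 * B)])
      (by linarith [le_max_right (x w) (2 * B)])
      (fun u hu => neg_le_neg ((hwmax hu).trans (le_max_left _ _)))
    · intro b' hb'
      filter_upwards [habs (-b') (by linarith [show B < b' from hb'])] with t ht
      linarith
    intro t ht n hn hwin hxb
    have ht0 := hβ' T hTτ t ht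
    have htT : T' + τ ≤ t := ht
    have hlarge : ∀ u ∈ Icc (t - τ) t, K' ≤ x u := by
      intro u hu
      by_contra hcon
      push Not at hcon
      have huT : T' ≤ u := by linarith [hu.1]
      have hu0 : 0 < u := by linarith
      have hg := aux_grow x F β I δ τ P (K' * Real.exp (δ * C')) u hδ hPpos (by positivity) hu0 hτ0
        hd hI (hIm.monotoneOn _) hβ
        (by
          intro s hs M hM
          have hs0 : 0 ≤ s := hu0.le.trans hs
          rw [hFdef, hP, Finset.sum_mul]
          refine Finset.sum_le_sum fun j _ => ?_
          have h1 := hM _ (hτmem j s hs0)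
          have h2 : 0 ≤ x (s - τd j s) := hxnn _ (by linarith [(hτmem j s hs0).1])
          have h3 : 0 ≤ x (s - σd j s) := hxnn _ (by linarith [(hσmem j s hs0).1])
          have h4 := hpp j
          have h5 : Real.exp (-(a j * x (s - σd j s))) ≤ 1 :=
            Real.exp_le_one_iff.2 (by have := mul_nonneg (hap j).le h3; linarith)
          calc p j * x (s - τd j s) * Real.exp (-(a j * x (s - σd j s)))
              ≤ p j * x (s - τd j s) * 1 := by gcongr
            _ ≤ p j * M := by rw [mul_one]; gcongr)
        (by
          intro v hv
          have h1 := hdecay v u (by linarith [hv.1]) hv.2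
          have h2 : I u - I v ≤ C' := by
            have := hT' u huT
            have := hIm hv.1
            linarith
          refine h1.trans ?_
          have := hxpos u hu0.le
          gcongr)
        t hu.2
      have h2 : I t - I u ≤ C' := by
        have := hT' t (by linarith)
        have := hIm hu.1
        linarith
      have h3 : K' * Real.exp (δ * C') * Real.exp (P * (I t - I u)) ≤
          K' * Real.exp (δ * C') * Real.exp (P * C') := by gcongr
      have h4 : K' * Real.exp (δ * C') * Real.exp (P * C') = B := by
        rw [hB, mul_assoc, ← Real.exp_add, add_mul]
      linarith
    rw [← mul_neg]
    refine mul_le_mul_of_nonneg_left ?_ (hβ t ht0.le).le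
    have : F t ≤ κ * (-n) := by
      rw [hκ, hFdef, Finset.sum_mul]
      refine Finset.sum_le_sum fun j _ => ?_
      have h1 := hwin _ (hτmem j t ht0.le)
      have h1' : x (t - τd j t) ≤ -n := by linarith
      have h2 := hlarge _ (hσmem j t ht0.le)
      have h3 := hap j
      have h4 := hpp j
      have h5 : 0 ≤ x (t - τd j t) := hxnn _ (by linarith [(hτmem j t ht0.le).1])
      calc p j * x (t - τd j t) * Real.exp (-(a j * x (t - σd j t)))
          ≤ p j * (-n) * Real.exp (-(a j * K')) := by gcongr; exact mul_nonneg h4.le (h5.trans h1')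
        _ = _ := by ring
    linarith
  -- conclusion
  have hbdA : IsBoundedUnder (· ≤ ·) atTop x :=
    isBoundedUnder_of_eventually_le (hupp (K + 1) (C + 1) (by linarith) (by linarith)
      ((K + 1) * Real.exp ((δ + P) * (C + 1)) + 1) (by linarith))
  have hbdB : IsBoundedUnder (· ≥ ·) atTop x :=
    isBoundedUnder_of_eventually_ge (a := 0)
      ((eventually_ge_atTop 0).mono fun t ht => (hxpos t ht).le)
  refine ⟨?_, liminf_le_limsup hbdA hbdB, ?_⟩
  · have h1 : K * Real.exp (-((2 * δ + P) * C)) ≤ K * Real.exp (-(δ * C)) := by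
      gcongr; linarith
    refine h1.trans (le_of_forall_lt fun r hr => ?_)
    have ht : Tendsto (fun ε : ℝ => (K - ε) * Real.exp (-(δ * (C + ε)))) (nhdsWithin 0 (Ioi 0))
        (nhds (K * Real.exp (-(δ * C)))) := by
      have hc : Continuous (fun ε : ℝ => (K - ε) * Real.exp (-(δ * (C + ε)))) := by fun_prop
      have := (hc.tendsto 0).mono_left (nhdsWithin_le_nhds (s := Ioi 0))
      simpa using this
    obtain ⟨ε, hε1, hε2⟩ := ((ht.eventually (lt_mem_nhds hr)).and (Ioo_mem_nhdsGT hKpos)).exists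
    obtain ⟨r', hr1, hr2⟩ := exists_between hε1
    exact lt_of_lt_of_le hr1 (le_liminf_of_le hbdA.isCoboundedUnder_ge
      (hlow (K - ε) (C + ε) (by linarith [hε2.2]) (by linarith [hε2.1]) (by linarith [hε2.1]) r' hr2))
  · have h1 : K * Real.exp ((δ + P) * C) ≤ K * Real.exp (2 * (δ + P) * C) := by
      gcongr; linarith
    refine le_trans (le_of_forall_gt fun r hr => ?_) h1
    have ht : Tendsto (fun ε : ℝ => (K + ε) * Real.exp ((δ + P) * (C + ε))) (nhdsWithin 0 (Ioi 0))
        (nhds (K * Real.exp ((δ + P) * C))) := by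
      have hc : Continuous (fun ε : ℝ => (K + ε) * Real.exp ((δ + P) * (C + ε))) := by fun_prop
      have := (hc.tendsto 0).mono_left (nhdsWithin_le_nhds (s := Ioi 0))
      simpa using this
    obtain ⟨ε, hε1, hε2⟩ := ((ht.eventually (gt_mem_nhds hr)).and (Ioo_mem_nhdsGT hKpos)).exists
    obtain ⟨r', hr1, hr2⟩ := exists_between hε1
    exact lt_of_le_of_lt (limsup_le_of_le hbdB.isCoboundedUnder_le
      (hupp (K + ε) (C + ε) (by linarith [hε2.1]) (by linarith [hε2.1]) r' hr1)) hr2
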